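/- arXiv:2409.04222 — 2 statements merged into one kernel-verified Lean document; each statement's English description precedes it below -/
import Mathlib

section
/- Let x̄ ∈ M_c be biactive and let SNO-LICQ hold at x̄. Then: (a) if −∇f(x̄) ∈ N_{M_c}(x̄) (the limiting normal cone of M_c at x̄), then x̄ is T-stationary, i.e., there exist multipliers λ_{1,i}, λ_{2,i} with ∇f(x̄) = Σ_{i=1}^m λ_{1,i}∇F_{1,i}(x̄) + λ_{2,i}∇F_{2,i}(x̄) and λ_{1,i}·λ_{2,i} ≥ 0 for all i; and (b) if x̄ is T-stationary, then −∇f(x̄) ∈ N̄_{M_c}(x̄) (the Clarke normal cone of M_c at x̄). -/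
open Filter Topology
open scoped RealInnerProductSpace

noncomputable section

/-- Tangent (Bouligand) cone: w ∈ T_M(x) iff there are x_k ∈ M, x_k → x, τ_k ↓ 0
with (x_k - x)/τ_k → w. -/
def tangentCone {n : ℕ} (M : Set (EuclideanSpace ℝ (Fin n))) (x : EuclideanSpace ℝ (Fin n)) :
    Set (EuclideanSpace ℝ (Fin n)) :=
  {w | ∃ (xs : ℕ → EuclideanSpace ℝ (Fin n)) (τ : ℕ → ℝ),
    (∀ k, xs k ∈ M) ∧ Tendsto xs atTop (𝓝 x) ∧
    (∀ k, 0 < τ k) ∧ Tendsto τ atTop (𝓝 0) ∧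
    Tendsto (fun k => (τ k)⁻¹ • (xs k - x)) atTop (𝓝 w)}

/-- Fréchet normal cone: v with ⟨v, w⟩ ≤ 0 for all tangent directions w. -/
def frechetNormalCone {n : ℕ} (M : Set (EuclideanSpace ℝ (Fin n)))
    (x : EuclideanSpace ℝ (Fin n)) : Set (EuclideanSpace ℝ (Fin n)) :=
  {v | ∀ w ∈ tangentCone M x, ⟪v, w⟫ ≤ 0}

/-- Mordukhovich (limiting) normal cone. -/
def limitingNormalCone {n : ℕ} (M : Set (EuclideanSpace ℝ (Fin n)))
    (x : EuclideanSpace ℝ (Fin n)) : Set (EuclideanSpace ℝ (Fin n)) :=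
  {v | ∃ (xs vs : ℕ → EuclideanSpace ℝ (Fin n)),
    (∀ k, xs k ∈ M) ∧ Tendsto xs atTop (𝓝 x) ∧
    (∀ k, vs k ∈ frechetNormalCone M (xs k)) ∧ Tendsto vs atTop (𝓝 v)}

/-- Clarke normal cone: closed convex hull of the limiting normal cone. -/
def clarkeNormalCone {n : ℕ} (M : Set (EuclideanSpace ℝ (Fin n)))
    (x : EuclideanSpace ℝ (Fin n)) : Set (EuclideanSpace ℝ (Fin n)) :=
  closure (convexHull ℝ (limitingNormalCone M x))

/-- The MPCC feasible set. -/
def MpccSet {n m : ℕ} (F1 F2 : Fin m → EuclideanSpace ℝ (Fin n) → ℝ) :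
    Set (EuclideanSpace ℝ (Fin n)) :=
  {y | ∀ i, F1 i y * F2 i y = 0 ∧ 0 ≤ F1 i y ∧ 0 ≤ F2 i y}

/-- The linear map sending multipliers `μ` to `∑ i, μ i • ∇ g i y`. -/
def gradientCombination {n : ℕ} {ι : Type*} [Fintype ι]
    (g : ι → EuclideanSpace ℝ (Fin n) → ℝ) (y : EuclideanSpace ℝ (Fin n)) :
    EuclideanSpace ℝ ι →L[ℝ] EuclideanSpace ℝ (Fin n) :=
  ∑ i, (EuclideanSpace.proj i : EuclideanSpace ℝ ι →L[ℝ] ℝ).smulRight (gradient (g i) y)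

section

variable {n m : ℕ} {ι : Type*} [Fintype ι]

theorem gradientCombination_apply (g : ι → EuclideanSpace ℝ (Fin n) → ℝ)
    (y : EuclideanSpace ℝ (Fin n)) (μ : EuclideanSpace ℝ ι) :
    gradientCombination g y μ = ∑ i, μ i • gradient (g i) y := by
  simp [gradientCombination]

theorem ContDiff.continuous_gradient {h : EuclideanSpace ℝ (Fin n) → ℝ} (hh : ContDiff ℝ 1 h) :
    Continuous (gradient h) :=
  (InnerProductSpace.toDual ℝ (EuclideanSpace ℝ (Fin n))).symm.continuous.comp
    (hh.continuous_fderiv one_ne_zero)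

theorem inner_gradient_eq_fderiv (h : EuclideanSpace ℝ (Fin n) → ℝ)
    (y w : EuclideanSpace ℝ (Fin n)) : ⟪gradient h y, w⟫ = fderiv ℝ h y w := by
  simp [gradient]

theorem continuous_gradientCombination {g : ι → EuclideanSpace ℝ (Fin n) → ℝ}
    (hg : ∀ i, ContDiff ℝ 1 (g i)) : Continuous (gradientCombination g) := by
  unfold gradientCombination
  refine continuous_finsetSum _ fun i _ => ?_
  exact ((ContinuousLinearMap.smulRightL ℝ (EuclideanSpace ℝ ι) (EuclideanSpace ℝ (Fin n))
    (EuclideanSpace.proj i)).continuous).comp (hg i).continuous_gradient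

theorem adjoint_gradientCombination_apply (g : ι → EuclideanSpace ℝ (Fin n) → ℝ)
    (y w : EuclideanSpace ℝ (Fin n)) (i : ι) :
    (gradientCombination g y).adjoint w i = ⟪gradient (g i) y, w⟫ := by
  classical
  have h : ⟪EuclideanSpace.single i (1 : ℝ), (gradientCombination g y).adjoint w⟫ =
      ⟪gradient (g i) y, w⟫ := by
    rw [ContinuousLinearMap.adjoint_inner_right, gradientCombination_apply]
    simp
  rw [EuclideanSpace.inner_single_left] at h
  simpa using h

theorem hasStrictFDerivAt_toLp {g : ι → EuclideanSpace ℝ (Fin n) → ℝ}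
    (hg : ∀ i, ContDiff ℝ 1 (g i)) (y : EuclideanSpace ℝ (Fin n)) :
    HasStrictFDerivAt (fun z => (WithLp.toLp 2 fun i => g i z : EuclideanSpace ℝ ι))
      (gradientCombination g y).adjoint y := by
  rw [hasStrictFDerivAt_euclidean]
  intro i
  refine ((hg i).contDiffAt.hasStrictFDerivAt one_ne_zero).congr_fderiv ?_
  ext1 w
  simp [adjoint_gradientCombination_apply]

theorem tendsto_clm_apply {α E G : Type*} [NormedAddCommGroup E] [NormedSpace ℝ E]
    [NormedAddCommGroup G] [NormedSpace ℝ G] {l : Filter α} {A : α → E →L[ℝ] G} {A₀ : E →L[ℝ] G}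
    {u : α → E} {u₀ : E} (hA : Tendsto A l (𝓝 A₀)) (hu : Tendsto u l (𝓝 u₀)) :
    Tendsto (fun a => A a (u a)) l (𝓝 (A₀ u₀)) :=
  (isBoundedBilinearMap_apply.continuous.tendsto (A₀, u₀)).comp (hA.prodMk_nhds hu)

/-- If the gradients at `x` are linearly independent, the maps `gradientCombination g y` have left
inverses for `y` near `x`, continuous at `x`. -/
theorem exists_leftInverse_gradientCombination {g : ι → EuclideanSpace ℝ (Fin n) → ℝ}
    (hg : ∀ i, ContDiff ℝ 1 (g i)) {x : EuclideanSpace ℝ (Fin n)}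
    (hx : LinearIndependent ℝ fun i => gradient (g i) x) :
    ∃ L : EuclideanSpace ℝ (Fin n) → EuclideanSpace ℝ (Fin n) →L[ℝ] EuclideanSpace ℝ ι,
      ContinuousAt L x ∧ ∀ᶠ y in 𝓝 x, ∀ μ, L y (gradientCombination g y μ) = μ := by
  have hinj : LinearMap.ker (gradientCombination g x).toLinearMap = ⊥ := by
    rw [LinearMap.ker_eq_bot']
    intro μ hμ
    rw [ContinuousLinearMap.coe_coe, gradientCombination_apply] at hμ
    ext i
    exact Fintype.linearIndependent_iff.1 hx _ hμ i
  obtain ⟨B₀, hB₀⟩ := LinearMap.exists_leftInverse_of_injective _ hinj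
  set B := LinearMap.toContinuousLinearMap B₀
  set K := fun y => B ∘L gradientCombination g y with hK
  have hKc : Continuous K := continuous_const.clm_comp (continuous_gradientCombination hg)
  have hKx : K x = 1 := by
    ext1 μ
    exact LinearMap.congr_fun hB₀ μ
  have hinv : ContinuousAt (fun y => Ring.inverse (K y)) x := by
    refine ContinuousAt.comp (g := Ring.inverse) ?_ hKc.continuousAt
    rw [hKx]
    exact NormedRing.inverse_continuousAt 1
  refine ⟨fun y => Ring.inverse (K y) ∘L B, hinv.clm_comp continuousAt_const, ?_⟩
  have hunit : ∀ᶠ y in 𝓝 x, IsUnit (K y) := by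
    refine hKc.continuousAt.eventually ?_
    rw [hKx]
    exact Units.isOpen.mem_nhds isUnit_one
  filter_upwards [hunit] with y hy μ
  exact DFunLike.congr_fun (Ring.inverse_mul_cancel _ hy) μ

/-- A map that is strictly differentiable at `y` with derivative `A` having a right inverse can be
linearised along curves: it is affine along a curve with prescribed velocity `w`. -/
theorem HasStrictFDerivAt.exists_curve {E G : Type*} [NormedAddCommGroup E] [NormedSpace ℝ E]
    [CompleteSpace E] [NormedAddCommGroup G] [NormedSpace ℝ G] {F : E → G} {A : E →L[ℝ] G}
    {y : E} (hF : HasStrictFDerivAt F A y) {R : G →L[ℝ] E} (hR : ∀ c, A (R c) = c) (w : E) :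
    ∃ γ : ℝ → E, γ 0 = y ∧ HasDerivAt γ w 0 ∧ ∀ᶠ t in 𝓝 0, F (γ t) = F y + t • A w := by
  set H : E → E := fun z => z + R (F z - A z) with hHdef
  have hH : HasStrictFDerivAt H ((ContinuousLinearEquiv.refl ℝ E : E ≃L[ℝ] E) : E →L[ℝ] E) y := by
    have h := (hasStrictFDerivAt_id y).add
      (R.hasStrictFDerivAt.comp y (hF.sub A.hasStrictFDerivAt))
    refine h.congr_fderiv ?_
    ext1 v
    simp
  have hAH : ∀ z, A (H z) = F z := fun z => by simp [hHdef, hR]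
  have hline : HasDerivAt (fun t : ℝ => H y + t • w) w 0 := by
    simpa using ((hasDerivAt_id (0 : ℝ)).smul_const w).const_add (H y)
  have hψ := hH.to_localInverse.hasFDerivAt
  refine ⟨fun t => hH.localInverse H _ y (H y + t • w), ?_, ?_, ?_⟩
  · simp
  · have h0 : H y = H y + (0 : ℝ) • w := by simp
    rw [h0] at hψ
    exact hψ.comp_hasDerivAt (0 : ℝ) hline
  · have hc : Tendsto (fun t : ℝ => H y + t • w) (𝓝 0) (𝓝 (H y)) := by
      simpa using hline.continuousAt.tendsto
    filter_upwards [hc.eventually hH.eventually_right_inverse] with t ht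
    rw [← hAH, ht, map_add, map_smul, hAH]

theorem HasDerivAt.mem_tangentCone {M : Set (EuclideanSpace ℝ (Fin n))}
    {γ : ℝ → EuclideanSpace ℝ (Fin n)} {w : EuclideanSpace ℝ (Fin n)} (hγ : HasDerivAt γ w 0)
    (hM : ∀ᶠ t in 𝓝[>] 0, γ t ∈ M) : w ∈ tangentCone M (γ 0) := by
  obtain ⟨τ, hτ, h⟩ := exists_seq_forall_of_frequently
    (hM.and self_mem_nhdsWithin).frequently
  have hτ0 : Tendsto τ atTop (𝓝 0) := hτ.mono_right nhdsWithin_le_nhds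
  refine ⟨fun k => γ (τ k), τ, fun k => (h k).1, hγ.continuousAt.tendsto.comp hτ0,
    fun k => (h k).2, hτ0, ?_⟩
  have hs := hγ.tendsto_slope_zero_right.comp hτ
  simpa [Function.comp_def] using hs

theorem inner_gradient_eq_zero_of_mem_tangentCone {M : Set (EuclideanSpace ℝ (Fin n))}
    {h : EuclideanSpace ℝ (Fin n) → ℝ} {y w : EuclideanSpace ℝ (Fin n)}
    (hd : DifferentiableAt ℝ h y) (hy : h y = 0) (hM : ∀ᶠ z in 𝓝 y, z ∈ M → h z = 0)
    (hw : w ∈ tangentCone M y) : ⟪gradient h y, w⟫ = 0 := by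
  obtain ⟨xs, τ, hxs, hx, hτ, hτ0, hlim⟩ := hw
  rw [inner_gradient_eq_fderiv]
  have hd0 : Tendsto (fun k => xs k - y) atTop (𝓝 0) := by
    simpa using hx.sub_const y
  have key := (hasFDerivWithinAt_univ.2 hd.hasFDerivAt).lim hd0
    (Eventually.of_forall fun _ => Set.mem_univ _) hlim
  refine tendsto_nhds_unique key (tendsto_const_nhds.congr' ?_)
  filter_upwards [hx.eventually hM] with k hk
  simp [hk (hxs k), hy]

/-- The pair of constraint families as a single family. -/
abbrev constraintPair (F1 F2 : Fin m → EuclideanSpace ℝ (Fin n) → ℝ) :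
    Fin m ⊕ Fin m → EuclideanSpace ℝ (Fin n) → ℝ :=
  Sum.elim F1 F2

/-- A Fréchet normal of the MPCC set at a point where the gradients are independent is a combination
of the gradients, with multipliers whose products are nonnegative. -/
theorem mul_nonneg_of_mem_frechetNormalCone {F1 F2 : Fin m → EuclideanSpace ℝ (Fin n) → ℝ}
    (hg : ∀ i, ContDiff ℝ 1 (constraintPair F1 F2 i)) {y v : EuclideanSpace ℝ (Fin n)}
    (hy : y ∈ MpccSet F1 F2) (hv : v ∈ frechetNormalCone (MpccSet F1 F2) y)
    {L : EuclideanSpace ℝ (Fin n) →L[ℝ] EuclideanSpace ℝ (Fin m ⊕ Fin m)}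
    (hL : ∀ μ, L (gradientCombination (constraintPair F1 F2) y μ) = μ) :
    gradientCombination (constraintPair F1 F2) y (L v) = v ∧
      ∀ i, 0 ≤ L v (Sum.inl i) * L v (Sum.inr i) := by
  set T := gradientCombination (constraintPair F1 F2) y with hT
  have hR : ∀ c, T.adjoint (L.adjoint c) = c := fun c => by
    refine ext_inner_left ℝ fun μ => ?_
    rw [ContinuousLinearMap.adjoint_inner_right, ContinuousLinearMap.adjoint_inner_right, hL]
  have hle : ∀ w, (∀ᶠ t : ℝ in 𝓝[>] 0, ∀ i,
      (F1 i y + t * T.adjoint w (Sum.inl i)) * (F2 i y + t * T.adjoint w (Sum.inr i)) = 0 ∧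
      0 ≤ F1 i y + t * T.adjoint w (Sum.inl i) ∧ 0 ≤ F2 i y + t * T.adjoint w (Sum.inr i)) →
      ⟪v, w⟫ ≤ 0 := by
    intro w hw
    obtain ⟨γ, hγ0, hγ, hFγ⟩ := (hasStrictFDerivAt_toLp hg y).exists_curve hR w
    apply hv
    rw [← hγ0]
    refine hγ.mem_tangentCone ?_
    filter_upwards [hw, hFγ.filter_mono nhdsWithin_le_nhds] with t ht hFt i
    have h1 := congrArg (fun u => u (Sum.inl i)) hFt
    have h2 := congrArg (fun u => u (Sum.inr i)) hFt
    simp only [Sum.elim_inl, Sum.elim_inr, PiLp.add_apply, PiLp.smul_apply, smul_eq_mul] at h1 h2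
    rw [h1, h2]
    exact ht i
  have hzero : ∀ w, T.adjoint w = 0 → ⟪v, w⟫ ≤ 0 := fun w hw => hle w <| by
    rw [hw]
    exact Eventually.of_forall fun t k => by simpa using hy k
  have hTL : T (L v) = v := by
    refine ext_inner_right ℝ fun w => ?_
    have hw : T.adjoint (w - L.adjoint (T.adjoint w)) = 0 := by rw [map_sub, hR, sub_self]
    have h1 := hzero _ hw
    have h2 := hzero (-(w - L.adjoint (T.adjoint w))) (by rw [map_neg, hw, neg_zero])
    rw [inner_neg_right] at h2
    rw [inner_sub_right, ContinuousLinearMap.adjoint_inner_right,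
      ContinuousLinearMap.adjoint_inner_right] at h1 h2
    linarith
  refine ⟨hTL, fun i => ?_⟩
  have hle' : ∀ j (s : ℝ), (∀ᶠ t : ℝ in 𝓝[>] 0, ∀ i,
      (F1 i y + t * Pi.single (M := fun _ => ℝ) j s (Sum.inl i)) *
        (F2 i y + t * Pi.single (M := fun _ => ℝ) j s (Sum.inr i)) = 0 ∧
      0 ≤ F1 i y + t * Pi.single (M := fun _ => ℝ) j s (Sum.inl i) ∧
      0 ≤ F2 i y + t * Pi.single (M := fun _ => ℝ) j s (Sum.inr i)) →
      s * L v j ≤ 0 := by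
    intro j s hs
    have := hle (L.adjoint (EuclideanSpace.single j s)) (by rw [hR]; exact hs)
    rw [ContinuousLinearMap.adjoint_inner_right] at this
    simpa [EuclideanSpace.inner_single_right] using this
  have hsmall : ∀ a : ℝ, 0 < a → ∀ᶠ t : ℝ in 𝓝[>] 0, t < a := fun a ha =>
    (eventually_lt_nhds ha).filter_mono nhdsWithin_le_nhds
  obtain ⟨hprod, h1, h2⟩ := hy i
  have hstep1 : ∀ s : ℝ, F2 i y = 0 → (0 ≤ s ∨ (-1 ≤ s ∧ 0 < F1 i y)) →
      s * L v (Sum.inl i) ≤ 0 := by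
    intro s h20 hs
    apply hle'
    have hev : ∀ᶠ t : ℝ in 𝓝[>] 0, 0 ≤ F1 i y + t * s := by
      rcases hs with hs | ⟨hs, hpos⟩
      · filter_upwards [self_mem_nhdsWithin] with t ht
        exact add_nonneg h1 (mul_nonneg (le_of_lt ht) hs)
      · filter_upwards [self_mem_nhdsWithin, hsmall _ hpos] with t ht hlt
        nlinarith [Set.mem_Ioi.1 ht]
    filter_upwards [hev] with t ht k
    by_cases hk : k = i
    · subst hk; simp [h20, ht]
    · simpa [Pi.single_apply, hk] using hy k
  have hstep2 : ∀ s : ℝ, F1 i y = 0 → (0 ≤ s ∨ (-1 ≤ s ∧ 0 < F2 i y)) →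
      s * L v (Sum.inr i) ≤ 0 := by
    intro s h10 hs
    apply hle'
    have hev : ∀ᶠ t : ℝ in 𝓝[>] 0, 0 ≤ F2 i y + t * s := by
      rcases hs with hs | ⟨hs, hpos⟩
      · filter_upwards [self_mem_nhdsWithin] with t ht
        exact add_nonneg h2 (mul_nonneg (le_of_lt ht) hs)
      · filter_upwards [self_mem_nhdsWithin, hsmall _ hpos] with t ht hlt
        nlinarith [Set.mem_Ioi.1 ht]
    filter_upwards [hev] with t ht k
    by_cases hk : k = i
    · subst hk; simp [h10, ht]
    · simpa [Pi.single_apply, hk] using hy k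
  rcases h1.eq_or_lt with h10 | h1pos
  · rcases h2.eq_or_lt with h20 | h2pos
    · have a := hstep1 1 h20.symm (Or.inl zero_le_one)
      have b := hstep2 1 h10.symm (Or.inl zero_le_one)
      exact mul_nonneg_of_nonpos_of_nonpos (by linarith) (by linarith)
    · have a := hstep2 1 h10.symm (Or.inl zero_le_one)
      have b := hstep2 (-1) h10.symm (Or.inr ⟨le_rfl, h2pos⟩)
      rw [show L v (Sum.inr i) = 0 by linarith, mul_zero]
  · have h20 : F2 i y = 0 := (mul_eq_zero.1 hprod).resolve_left h1pos.ne'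
    have a := hstep1 1 h20 (Or.inl zero_le_one)
    have b := hstep1 (-1) h20 (Or.inr ⟨le_rfl, h1pos⟩)
    rw [show L v (Sum.inl i) = 0 by linarith, zero_mul]

theorem mpccSet_comm (F1 F2 : Fin m → EuclideanSpace ℝ (Fin n) → ℝ) :
    MpccSet F1 F2 = MpccSet F2 F1 := by
  ext y
  exact forall_congr' fun i => by rw [mul_comm, and_comm (a := 0 ≤ F1 i y)]

/-- If `x` is approached along a curve in the branch `F1 = 0`, `F2 > 0`, every combination of the
gradients of `F1` is a limiting normal. -/
theorem sum_smul_gradient_mem_limitingNormalCone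
    {F1 F2 : Fin m → EuclideanSpace ℝ (Fin n) → ℝ} (hF1 : ∀ i, ContDiff ℝ 1 (F1 i))
    (hF2 : ∀ i, ContDiff ℝ 1 (F2 i)) {x : EuclideanSpace ℝ (Fin n)}
    {γ : ℝ → EuclideanSpace ℝ (Fin n)} (hγ : Tendsto γ (𝓝[>] 0) (𝓝 x))
    (h : ∀ᶠ t in 𝓝[>] 0, ∀ i, F1 i (γ t) = 0 ∧ F2 i (γ t) = t) (μ : Fin m → ℝ) :
    ∑ i, μ i • gradient (F1 i) x ∈ limitingNormalCone (MpccSet F1 F2) x := by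
  obtain ⟨τ, hτ, hP⟩ := exists_seq_forall_of_frequently
    (h.and self_mem_nhdsWithin).frequently
  have hx : Tendsto (fun k => γ (τ k)) atTop (𝓝 x) := hγ.comp hτ
  refine ⟨fun k => γ (τ k), fun k => ∑ i, μ i • gradient (F1 i) (γ (τ k)), ?_, hx, ?_, ?_⟩
  · intro k i
    rw [((hP k).1 i).1, ((hP k).1 i).2]
    exact ⟨zero_mul _, le_rfl, le_of_lt (hP k).2⟩
  · intro k w hw
    rw [sum_inner]
    refine (Finset.sum_eq_zero fun i _ => ?_).le
    rw [real_inner_smul_left, inner_gradient_eq_zero_of_mem_tangentCone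
      ((hF1 i).differentiable one_ne_zero _) ((hP k).1 i).1 ?_ hw, mul_zero]
    have hpos : 0 < F2 i (γ (τ k)) := (hP k).2.trans_eq ((hP k).1 i).2.symm
    filter_upwards [(hF2 i).continuous.continuousAt.eventually (eventually_gt_nhds hpos)]
      with z hz hzM
    exact (mul_eq_zero.1 (hzM i).1).resolve_right hz.ne'
  · exact tendsto_finsetSum _ fun i _ =>
      (((hF1 i).continuous_gradient.tendsto x).comp hx).const_smul (μ i)

end

/-- For MPCC at a biactive point with SNO-LICQ:
(a) limiting-normal stationarity implies T-stationarity;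
(b) T-stationarity implies Clarke-normal stationarity. -/
theorem mpcc_N_implies_T_implies_Clarke {n m : ℕ}
    (f : EuclideanSpace ℝ (Fin n) → ℝ) (F1 F2 : Fin m → EuclideanSpace ℝ (Fin n) → ℝ)
    (hf : ContDiff ℝ 1 f) (hF1 : ∀ i, ContDiff ℝ 1 (F1 i)) (hF2 : ∀ i, ContDiff ℝ 1 (F2 i))
    (x : EuclideanSpace ℝ (Fin n))
    (hbi : ∀ i, F1 i x = 0 ∧ F2 i x = 0)
    (hLICQ : LinearIndependent ℝ
      (Sum.elim (fun i => gradient (F1 i) x) (fun i => gradient (F2 i) x))) :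
    (-gradient f x ∈ limitingNormalCone (MpccSet F1 F2) x →
      ∃ l1 l2 : Fin m → ℝ, (∀ i, 0 ≤ l1 i * l2 i) ∧
        gradient f x = ∑ i, (l1 i • gradient (F1 i) x + l2 i • gradient (F2 i) x)) ∧
    ((∃ l1 l2 : Fin m → ℝ, (∀ i, 0 ≤ l1 i * l2 i) ∧
        gradient f x = ∑ i, (l1 i • gradient (F1 i) x + l2 i • gradient (F2 i) x)) →
      -gradient f x ∈ clarkeNormalCone (MpccSet F1 F2) x) := by
  have hg : ∀ i, ContDiff ℝ 1 (constraintPair F1 F2 i) := by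
    rintro (i | i)
    exacts [hF1 i, hF2 i]
  have hli : LinearIndependent ℝ fun i => gradient (constraintPair F1 F2 i) x := by
    convert hLICQ using 1
    ext1 i
    cases i <;> rfl
  obtain ⟨L, hLc, hL⟩ := exists_leftInverse_gradientCombination hg hli
  constructor
  · rintro ⟨xs, vs, hxs, hx, hvs, hv⟩
    have hlim : Tendsto (fun k => L (xs k) (vs k)) atTop (𝓝 (L x (-gradient f x))) :=
      tendsto_clm_apply (hLc.tendsto.comp hx) hv
    have hcoord : ∀ j, Tendsto (fun k => L (xs k) (vs k) j) atTop
        (𝓝 (L x (-gradient f x) j)) := fun j =>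
      ((EuclideanSpace.proj j : EuclideanSpace ℝ (Fin m ⊕ Fin m) →L[ℝ] ℝ).continuous.tendsto _).comp
        hlim
    have hev := (hx.eventually hL).mono fun k hk =>
      mul_nonneg_of_mem_frechetNormalCone hg (hxs k) (hvs k) hk
    have heq : gradientCombination (constraintPair F1 F2) x (L x (-gradient f x)) =
        -gradient f x := by
      refine tendsto_nhds_unique ?_ hv
      refine (tendsto_clm_apply (((continuous_gradientCombination hg).tendsto x).comp hx)
        hlim).congr' ?_
      filter_upwards [hev] with k hk using hk.1
    refine ⟨fun i => -L x (-gradient f x) (Sum.inl i), fun i => -L x (-gradient f x) (Sum.inr i),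
      fun i => ?_, ?_⟩
    · rw [neg_mul_neg]
      exact ge_of_tendsto ((hcoord (Sum.inl i)).mul (hcoord (Sum.inr i)))
        (hev.mono fun k hk => hk.2 i)
    · rw [gradientCombination_apply, Fintype.sum_sum_type] at heq
      simp only [neg_smul, Finset.sum_add_distrib, Finset.sum_neg_distrib]
      simp only [Sum.elim_inl, Sum.elim_inr] at heq
      rw [← neg_add, heq, neg_neg]
  · rintro ⟨l1, l2, -, hl⟩
    have hR : ∀ c, (gradientCombination (constraintPair F1 F2) x).adjoint ((L x).adjoint c) = c :=
      fun c => by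
        refine ext_inner_left ℝ fun μ => ?_
        rw [ContinuousLinearMap.adjoint_inner_right, ContinuousLinearMap.adjoint_inner_right,
          hL.self_of_nhds]
    have hcurve : ∀ c : EuclideanSpace ℝ (Fin m ⊕ Fin m), ∃ γ : ℝ → EuclideanSpace ℝ (Fin n),
        Tendsto γ (𝓝[>] 0) (𝓝 x) ∧ ∀ᶠ t in 𝓝[>] 0, ∀ i,
          F1 i (γ t) = t * c (Sum.inl i) ∧ F2 i (γ t) = t * c (Sum.inr i) := by
      intro c
      obtain ⟨γ, hγ0, hγ, hFγ⟩ :=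
        (hasStrictFDerivAt_toLp hg x).exists_curve hR ((L x).adjoint c)
      refine ⟨γ, ?_, ?_⟩
      · rw [← hγ0]
        exact hγ.continuousAt.tendsto.mono_left nhdsWithin_le_nhds
      · filter_upwards [hFγ.filter_mono nhdsWithin_le_nhds] with t ht i
        rw [hR] at ht
        have h1 := congrArg (fun u => u (Sum.inl i)) ht
        have h2 := congrArg (fun u => u (Sum.inr i)) ht
        simpa [(hbi i).1, (hbi i).2] using And.intro h1 h2
    obtain ⟨γ₁, hγ₁, h₁⟩ := hcurve (WithLp.toLp 2 (Sum.elim (fun _ => 0) fun _ => 1))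
    obtain ⟨γ₂, hγ₂, h₂⟩ := hcurve (WithLp.toLp 2 (Sum.elim (fun _ => 1) fun _ => 0))
    have hN1 := sum_smul_gradient_mem_limitingNormalCone hF1 hF2 hγ₁
      (by simpa using h₁) fun i => -2 * l1 i
    have hN2 := sum_smul_gradient_mem_limitingNormalCone hF2 hF1 hγ₂
      (by simpa [and_comm] using h₂) fun i => -2 * l2 i
    rw [mpccSet_comm] at hN2
    apply subset_closure
    have hmem := convex_convexHull ℝ (limitingNormalCone (MpccSet F1 F2) x)
      (subset_convexHull ℝ _ hN1) (subset_convexHull ℝ _ hN2)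
      (a := 1 / 2) (b := 1 / 2) (by norm_num) (by norm_num) (by norm_num)
    convert hmem using 1
    rw [hl, Finset.smul_sum, Finset.smul_sum, ← Finset.sum_add_distrib, ← Finset.sum_neg_distrib]
    refine Finset.sum_congr rfl fun i _ => ?_
    module
end
end

section
/- Let x̄ ∈ M_c be biactive, let SNO-LICQ hold at x̄, and suppose x̄ is T-stationary with multipliers λ_{1,i}, λ_{2,i}, i.e., ∇f(x̄) = Σ_{i=1}^m λ_{1,i}∇F_{1,i}(x̄) + λ_{2,i}∇F_{2,i}(x̄) and λ_{1,i}·λ_{2,i} ≥ 0 for all i. Then −∇f(x̄) ∉ N̂_{M_c}(x̄) (x̄ is not Fréchet-stationary) if and only if x̄ is a saddle point of first order, i.e., there exists an index i with λ_{1,i} ≤ 0, λ_{2,i} ≤ 0 and (λ_{1,i}, λ_{2,i}) ≠ (0,0). -/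
open Filter Topology
open scoped RealInnerProductSpace

noncomputable section

theorem mem_tangentCone_of_hasDerivAt {n : ℕ} {M : Set (EuclideanSpace ℝ (Fin n))}
    {x w : EuclideanSpace ℝ (Fin n)} {c : ℝ → EuclideanSpace ℝ (Fin n)}
    (hc : HasDerivAt c w 0) (hc0 : c 0 = x) (hM : ∀ᶠ t in 𝓝[>] (0 : ℝ), c t ∈ M) :
    w ∈ tangentCone M x := by
  obtain ⟨τ, hτ, hτM⟩ := exists_seq_forall_of_frequently
    (hM.and self_mem_nhdsWithin).frequently
  have hτ0 : Tendsto τ atTop (𝓝 0) := hτ.mono_right nhdsWithin_le_nhds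
  refine ⟨fun k => c (τ k), τ, fun k => (hτM k).1, ?_, fun k => (hτM k).2, hτ0, ?_⟩
  · have := hc.continuousAt.tendsto.comp hτ0
    rwa [hc0] at this
  · simpa [Function.comp_def, hc0] using hc.tendsto_slope_zero_right.comp hτ

theorem inner_gradient_nonneg_of_mem_tangentCone {n : ℕ} {M : Set (EuclideanSpace ℝ (Fin n))}
    {x w : EuclideanSpace ℝ (Fin n)} {F : EuclideanSpace ℝ (Fin n) → ℝ}
    (hF : DifferentiableAt ℝ F x) (hx : F x = 0) (hM : ∀ y ∈ M, 0 ≤ F y)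
    (hw : w ∈ tangentCone M x) : 0 ≤ ⟪gradient F x, w⟫ := by
  obtain ⟨xs, τ, hxM, hxs, hτ, -, hlim⟩ := hw
  have hd : Tendsto (fun k => xs k - x) atTop (𝓝 0) := by
    simpa using hxs.sub_const x
  have h := hF.hasGradientAt.hasFDerivAt.hasFDerivWithinAt (s := Set.univ)
    |>.lim hd (by simp) hlim
  refine ge_of_tendsto' h fun k => ?_
  have := hM _ (hxM k)
  have := (hτ k).le
  simp only [add_sub_cancel, hx, sub_zero, smul_eq_mul]
  positivity

/-- Near a point where the strict derivative is onto, every direction in the codomain is the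
image of a differentiable curve. -/
theorem HasStrictFDerivAt.exists_curve_of_surjective {E F : Type*}
    [NormedAddCommGroup E] [NormedSpace ℝ E]
    [NormedAddCommGroup F] [NormedSpace ℝ F] [FiniteDimensional ℝ F]
    {G : E → F} {A : E →L[ℝ] F} {x : E} (hG : HasStrictFDerivAt G A x)
    (hA : Function.Surjective A) (v : F) :
    ∃ (c : ℝ → E) (w : E), A w = v ∧ HasDerivAt c w 0 ∧ c 0 = x ∧
      ∀ᶠ t in 𝓝 (0 : ℝ), G (c t) = G x + t • v := by
  have : CompleteSpace F := FiniteDimensional.complete ℝ F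
  obtain ⟨R, hR⟩ := A.exists_rightInverse_of_surjective (LinearMap.range_eq_top.2 hA)
  have hg : HasStrictFDerivAt (fun y : F => G (x + R y))
      ((ContinuousLinearEquiv.refl ℝ F : F ≃L[ℝ] F) : F →L[ℝ] F) 0 := by
    have h1 : HasStrictFDerivAt (fun y : F => x + R y) R 0 := R.hasStrictFDerivAt.const_add x
    have h2 : HasStrictFDerivAt G A (x + R 0) := by simpa using hG
    have := h2.comp (0 : F) h1
    rw [hR] at this
    exact this
  have h0 : hg.localInverse _ _ _ (G x) = 0 := by
    simpa using hg.localInverse_apply_image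
  have hl : HasDerivAt (fun t : ℝ => G x + t • v) v 0 := by
    simpa using ((hasDerivAt_id (0 : ℝ)).smul_const v).const_add (G x)
  have hinv := hg.to_localInverse.hasFDerivAt
  have hri := hg.eventually_right_inverse
  simp only [map_zero, add_zero] at hinv hri
  refine ⟨fun t => x + R (hg.localInverse _ _ _ (G x + t • v)), R v, ?_, ?_, ?_, ?_⟩
  · exact DFunLike.congr_fun hR v
  · have h3 := hinv.comp_hasDerivAt_of_eq (0 : ℝ) hl (by simp)
    exact (R.hasFDerivAt.comp_hasDerivAt (0 : ℝ) h3).const_add x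
  · simp [h0]
  · have ht : Tendsto (fun t : ℝ => G x + t • v) (𝓝 0) (𝓝 (G x)) := by
      simpa using hl.continuousAt.tendsto
    exact ht.eventually hri

theorem LinearIndependent.exists_inner_eq {E ι : Type*} [NormedAddCommGroup E]
    [InnerProductSpace ℝ E] [FiniteDimensional ℝ E] {g : ι → E} (hg : LinearIndependent ℝ g)
    (v : ι → ℝ) : ∃ w, ∀ i, ⟪g i, w⟫ = v i := by
  have : CompleteSpace E := FiniteDimensional.complete ℝ E
  let b := Module.Basis.sumExtend hg
  let φ : E →L[ℝ] ℝ := LinearMap.toContinuousLinearMap (b.constr ℝ (Sum.elim v 0))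
  refine ⟨(InnerProductSpace.toDual ℝ E).symm φ, fun i => ?_⟩
  rw [real_inner_comm, InnerProductSpace.toDual_symm_apply]
  have hb : b (Sum.inl i) = g i := by
    simp only [b, Module.Basis.sumExtend, Module.Basis.reindex_apply, Module.Basis.extend_apply_self]
    rfl
  rw [← hb]
  exact (b.constr_basis ℝ _ _).trans rfl

theorem exists_mem_tangentCone_mpccSet_inner_gradient_eq {n m : ℕ}
    {F1 F2 : Fin m → EuclideanSpace ℝ (Fin n) → ℝ}
    (hF1 : ∀ i, ContDiff ℝ 1 (F1 i)) (hF2 : ∀ i, ContDiff ℝ 1 (F2 i))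
    {x : EuclideanSpace ℝ (Fin n)} (hbi : ∀ i, F1 i x = 0 ∧ F2 i x = 0)
    (hLICQ : LinearIndependent ℝ
      (Sum.elim (fun i => gradient (F1 i) x) (fun i => gradient (F2 i) x)))
    {a b : Fin m → ℝ} (hab : ∀ i, a i * b i = 0) (ha : ∀ i, 0 ≤ a i) (hb : ∀ i, 0 ≤ b i) :
    ∃ w ∈ tangentCone (MpccSet F1 F2) x,
      ∀ i, ⟪gradient (F1 i) x, w⟫ = a i ∧ ⟪gradient (F2 i) x, w⟫ = b i := by
  let H : Fin m ⊕ Fin m → EuclideanSpace ℝ (Fin n) → ℝ := Sum.elim F1 F2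
  have hH : ∀ j, ContDiff ℝ 1 (H j) := by rintro (i | i); exacts [hF1 i, hF2 i]
  have hH0 : ∀ j, H j x = 0 := by rintro (i | i); exacts [(hbi i).1, (hbi i).2]
  have hLI : LinearIndependent ℝ (fun j => gradient (H j) x) := by
    convert hLICQ using 1
    ext1 (i | i) <;> rfl
  have hinner : ∀ j w, fderiv ℝ (H j) x w = ⟪gradient (H j) x, w⟫ := fun j w => by
    rw [← toDual_gradient, InnerProductSpace.toDual_apply_apply]
  have hG : HasStrictFDerivAt (fun y j => H j y)
      (ContinuousLinearMap.pi fun j => fderiv ℝ (H j) x) x :=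
    hasStrictFDerivAt_pi.2 fun j => (hH j).hasStrictFDerivAt one_ne_zero
  have hsurj : Function.Surjective (ContinuousLinearMap.pi fun j => fderiv ℝ (H j) x) := by
    intro v
    obtain ⟨w, hw⟩ := hLI.exists_inner_eq v
    exact ⟨w, funext fun j => (hinner j w).trans (hw j)⟩
  obtain ⟨c, w, hw, hc, hc0, hcG⟩ := hG.exists_curve_of_surjective hsurj (Sum.elim a b)
  refine ⟨w, mem_tangentCone_of_hasDerivAt hc hc0 ?_, fun i => ⟨?_, ?_⟩⟩
  · filter_upwards [hcG.filter_mono nhdsWithin_le_nhds, self_mem_nhdsWithin] with t ht ht0 i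
    have ht0 : 0 < t := ht0
    have h1 : F1 i (c t) = t * a i := by
      simpa [H, (hbi i).1] using congrFun ht (Sum.inl i)
    have h2 : F2 i (c t) = t * b i := by
      simpa [H, (hbi i).2] using congrFun ht (Sum.inr i)
    rw [h1, h2]
    refine ⟨by linear_combination t ^ 2 * hab i, ?_, ?_⟩
    · exact mul_nonneg ht0.le (ha i)
    · exact mul_nonneg ht0.le (hb i)
  · exact (hinner (Sum.inl i) w).symm.trans (congrFun hw (Sum.inl i))
  · exact (hinner (Sum.inr i) w).symm.trans (congrFun hw (Sum.inr i))

/-- A T-stationary point of MPCC (biactive, SNO-LICQ) fails to be Fréchet stationary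
iff it is a saddle point of first order. -/
theorem mpcc_T_not_frechet_iff_saddle_first_order {n m : ℕ}
    (f : EuclideanSpace ℝ (Fin n) → ℝ) (F1 F2 : Fin m → EuclideanSpace ℝ (Fin n) → ℝ)
    (hf : ContDiff ℝ 1 f) (hF1 : ∀ i, ContDiff ℝ 1 (F1 i)) (hF2 : ∀ i, ContDiff ℝ 1 (F2 i))
    (x : EuclideanSpace ℝ (Fin n))
    (hbi : ∀ i, F1 i x = 0 ∧ F2 i x = 0)
    (hLICQ : LinearIndependent ℝ
      (Sum.elim (fun i => gradient (F1 i) x) (fun i => gradient (F2 i) x)))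
    (l1 l2 : Fin m → ℝ) (hsign : ∀ i, 0 ≤ l1 i * l2 i)
    (hT : gradient f x = ∑ i, (l1 i • gradient (F1 i) x + l2 i • gradient (F2 i) x)) :
    -gradient f x ∉ frechetNormalCone (MpccSet F1 F2) x ↔
      ∃ i, l1 i ≤ 0 ∧ l2 i ≤ 0 ∧ ¬(l1 i = 0 ∧ l2 i = 0) := by
  have hpair : ∀ w, ⟪-gradient f x, w⟫ =
      -∑ i, (l1 i * ⟪gradient (F1 i) x, w⟫ + l2 i * ⟪gradient (F2 i) x, w⟫) := fun w => by
    simp only [hT, inner_neg_left, sum_inner, inner_add_left, real_inner_smul_left]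
  constructor
  · contrapose!
    intro hns w hw
    have hnonneg : ∀ i, 0 ≤ l1 i ∧ 0 ≤ l2 i := fun i => by
      have hs := hsign i
      have hi := hns i
      constructor <;> by_contra! hneg
      · have h2 : l2 i ≤ 0 := by nlinarith
        exact hneg.ne (hi hneg.le h2).1
      · have h1 : l1 i ≤ 0 := by nlinarith
        exact hneg.ne (hi h1 hneg.le).2
    rw [hpair, neg_nonpos]
    refine Finset.sum_nonneg fun i _ => add_nonneg ?_ ?_
    · exact mul_nonneg (hnonneg i).1 (inner_gradient_nonneg_of_mem_tangentCone
        ((hF1 i).differentiable one_ne_zero x) (hbi i).1 (fun y hy => (hy i).2.1) hw)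
    · exact mul_nonneg (hnonneg i).2 (inner_gradient_nonneg_of_mem_tangentCone
        ((hF2 i).differentiable one_ne_zero x) (hbi i).2 (fun y hy => (hy i).2.2) hw)
  · rintro ⟨i, h1, h2, hne⟩ hmem
    have hsingle : (0 : Fin m → ℝ) ≤ Pi.single i 1 := Pi.single_nonneg.2 zero_le_one
    by_cases h : l1 i = 0
    · obtain ⟨w, hw, hwi⟩ := exists_mem_tangentCone_mpccSet_inner_gradient_eq hF1 hF2 hbi hLICQ
        (a := 0) (b := Pi.single i 1) (by simp) (by simp) hsingle
      have hle := hmem w hw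
      rw [hpair] at hle
      simp only [hwi, Pi.single_apply] at hle
      simp at hle
      exact hne ⟨h, le_antisymm h2 hle⟩
    · obtain ⟨w, hw, hwi⟩ := exists_mem_tangentCone_mpccSet_inner_gradient_eq hF1 hF2 hbi hLICQ
        (a := Pi.single i 1) (b := 0) (by simp) hsingle (by simp)
      have hle := hmem w hw
      rw [hpair] at hle
      simp only [hwi, Pi.single_apply] at hle
      simp at hle
      exact h (le_antisymm h1 hle)
end
end
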